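/- For the ideal I = ⟨z² + x³y³, w⁵ + x⁵ + v³y²⟩ of ℂ[x,y,z,w,v], the derivative ideal satisfies Δ(I) = ⟨z, x²y³, x³y², w⁴, x⁴, v³y, v²y²⟩. -/

import Mathlib

open MvPolynomial

noncomputable def x : MvPolynomial (Fin 5) ℂ := X 0
noncomputable def y : MvPolynomial (Fin 5) ℂ := X 1
noncomputable def z : MvPolynomial (Fin 5) ℂ := X 2
noncomputable def w : MvPolynomial (Fin 5) ℂ := X 3
noncomputable def v : MvPolynomial (Fin 5) ℂ := X 4

/-- The derivative ideal Δ(I): the ideal generated by all elements of `I`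
together with all first-order partial derivatives of elements of `I`. -/
noncomputable def Delta (I : Ideal (MvPolynomial (Fin 5) ℂ)) :
    Ideal (MvPolynomial (Fin 5) ℂ) :=
  Ideal.span ((I : Set (MvPolynomial (Fin 5) ℂ)) ∪
    {g | ∃ f ∈ I, ∃ j : Fin 5, g = pderiv j f})

theorem pderiv_mem_Delta {I : Ideal (MvPolynomial (Fin 5) ℂ)} {f : MvPolynomial (Fin 5) ℂ}
    (hf : f ∈ I) (j : Fin 5) : pderiv j f ∈ Delta I :=
  Ideal.subset_span (Or.inr ⟨f, hf, j, rfl⟩)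

theorem Delta_span_le {S : Set (MvPolynomial (Fin 5) ℂ)} {K : Ideal (MvPolynomial (Fin 5) ℂ)}
    (hS : ∀ s ∈ S, s ∈ K) (hd : ∀ s ∈ S, ∀ j, pderiv j s ∈ K) :
    Delta (Ideal.span S) ≤ K := by
  have hle : Ideal.span S ≤ K := Ideal.span_le.2 hS
  refine Ideal.span_le.2 ?_
  rintro g (hg | ⟨f, hf, j, rfl⟩)
  · exact hle hg
  · change pderiv j f ∈ K
    induction hf using Submodule.span_induction with
    | mem s hs => exact hd s hs j
    | zero => simp
    | add a b _ _ ha hb => rw [map_add]; exact K.add_mem ha hb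
    | smul a b hb ih =>
      rw [smul_eq_mul, Derivation.leibniz, smul_eq_mul, smul_eq_mul]
      exact K.add_mem (K.mul_mem_left _ ih) (K.mul_mem_right _ (hle hb))

theorem mem_of_ofNat_mul_mem {J : Ideal (MvPolynomial (Fin 5) ℂ)} (n : ℕ) [n.AtLeastTwo]
    {a : MvPolynomial (Fin 5) ℂ}
    (h : (OfNat.ofNat n : MvPolynomial (Fin 5) ℂ) * a ∈ J) : a ∈ J := by
  have hu : IsUnit (C (OfNat.ofNat n : ℂ) : MvPolynomial (Fin 5) ℂ) :=
    (isUnit_iff_ne_zero.2 (OfNat.ofNat_ne_zero n)).map C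
  rw [map_ofNat] at hu
  exact (Ideal.unit_mul_mem_iff_mem J hu).1 h

theorem pderiv_z_sq_add (j : Fin 5) :
    pderiv j (z ^ 2 + x ^ 3 * y ^ 3) =
      ![3 * (x ^ 2 * y ^ 3), 3 * (x ^ 3 * y ^ 2), 2 * z, 0, 0] j := by
  fin_cases j <;> simp [x, y, z, pderiv_X, Derivation.leibniz, Derivation.leibniz_pow] <;> ring

theorem pderiv_w_pow_add (j : Fin 5) :
    pderiv j (w ^ 5 + x ^ 5 + v ^ 3 * y ^ 2) =
      ![5 * x ^ 4, 2 * (v ^ 3 * y), 0, 5 * w ^ 4, 3 * (v ^ 2 * y ^ 2)] j := by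
  fin_cases j <;> simp [x, y, w, v, pderiv_X, Derivation.leibniz, Derivation.leibniz_pow] <;> ring

theorem delta_I_eq :
    Delta (Ideal.span {z ^ 2 + x ^ 3 * y ^ 3, w ^ 5 + x ^ 5 + v ^ 3 * y ^ 2}) =
      Ideal.span {z, x ^ 2 * y ^ 3, x ^ 3 * y ^ 2, w ^ 4, x ^ 4,
        v ^ 3 * y, v ^ 2 * y ^ 2} := by
  apply le_antisymm
  · set K : Ideal (MvPolynomial (Fin 5) ℂ) := Ideal.span {z, x ^ 2 * y ^ 3, x ^ 3 * y ^ 2,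
      w ^ 4, x ^ 4, v ^ 3 * y, v ^ 2 * y ^ 2}
    have hz : z ∈ K := Ideal.subset_span (by simp)
    have hxy : x ^ 2 * y ^ 3 ∈ K := Ideal.subset_span (by simp)
    have hxy' : x ^ 3 * y ^ 2 ∈ K := Ideal.subset_span (by simp)
    have hw : w ^ 4 ∈ K := Ideal.subset_span (by simp)
    have hx : x ^ 4 ∈ K := Ideal.subset_span (by simp)
    have hvy : v ^ 3 * y ∈ K := Ideal.subset_span (by simp)
    have hvy' : v ^ 2 * y ^ 2 ∈ K := Ideal.subset_span (by simp)
    clear_value K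
    apply Delta_span_le
    · rintro s (rfl | rfl)
      · rw [show z ^ 2 + x ^ 3 * y ^ 3 = z * z + x * (x ^ 2 * y ^ 3) by ring]
        exact K.add_mem (K.mul_mem_left _ hz) (K.mul_mem_left _ hxy)
      · rw [show w ^ 5 + x ^ 5 + v ^ 3 * y ^ 2 = w * w ^ 4 + x * x ^ 4 + y * (v ^ 3 * y) by ring]
        exact K.add_mem (K.add_mem (K.mul_mem_left _ hw) (K.mul_mem_left _ hx))
          (K.mul_mem_left _ hvy)
    · rintro s (rfl | rfl) j
      · rw [pderiv_z_sq_add]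
        fin_cases j
        exacts [K.mul_mem_left _ hxy, K.mul_mem_left _ hxy', K.mul_mem_left _ hz,
          K.zero_mem, K.zero_mem]
      · rw [pderiv_w_pow_add]
        fin_cases j
        exacts [K.mul_mem_left _ hx, K.mul_mem_left _ hvy, K.zero_mem, K.mul_mem_left _ hw,
          K.mul_mem_left _ hvy']
  · set I : Ideal (MvPolynomial (Fin 5) ℂ) :=
      Ideal.span {z ^ 2 + x ^ 3 * y ^ 3, w ^ 5 + x ^ 5 + v ^ 3 * y ^ 2}
    have hf (j : Fin 5) := pderiv_z_sq_add j ▸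
      pderiv_mem_Delta (I := I) (Ideal.subset_span (Or.inl rfl)) j
    have hg (j : Fin 5) := pderiv_w_pow_add j ▸
      pderiv_mem_Delta (I := I) (Ideal.subset_span (Or.inr rfl)) j
    refine Ideal.span_le.2 ?_
    rintro s (rfl | rfl | rfl | rfl | rfl | rfl | rfl)
    exacts [mem_of_ofNat_mul_mem 2 (hf 2), mem_of_ofNat_mul_mem 3 (hf 0),
      mem_of_ofNat_mul_mem 3 (hf 1), mem_of_ofNat_mul_mem 5 (hg 3),
      mem_of_ofNat_mul_mem 5 (hg 0), mem_of_ofNat_mul_mem 2 (hg 1),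
      mem_of_ofNat_mul_mem 3 (hg 4)]
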